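/- arXiv:2503.00472 — 8 statements merged into one kernel-verified Lean document; each statement's English description precedes it below -/
import Mathlib

section
/- For the generalized friendship graph F_{4,n} with n ≥ 1, consisting of n cycles of length 4 meeting at a common vertex, the independent domination number satisfies γ_i(F_{4,n}) = n + 1. -/
/-- `S` is an independent dominating set of the simple graph `G`:
it is independent (no two vertices of `S` are adjacent) and dominating
(every vertex not in `S` has a neighbor in `S`). -/
def IsIndepDomSet {V : Type*} (G : SimpleGraph V) (S : Set V) : Prop :=
  (∀ a ∈ S, ∀ b ∈ S, ¬ G.Adj a b) ∧ (∀ v ∉ S, ∃ u ∈ S, G.Adj u v)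

/-- The independent domination number `γᵢ(G)`: the minimum size of an
independent dominating set of `G`. -/
noncomputable def indepDomNum {V : Type*} (G : SimpleGraph V) : ℕ :=
  sInf {n | ∃ S : Set V, IsIndepDomSet G S ∧ S.ncard = n}

/-- The independent domination bondage number `b_id(G)`: the minimum size of a
nonempty set `E'` of edges of `G` whose deletion changes the independent
domination number. -/
noncomputable def idBondage {V : Type*} (G : SimpleGraph V) : ℕ :=
  sInf {n | ∃ E' : Set (Sym2 V), E' ⊆ G.edgeSet ∧ E'.Nonempty ∧
    indepDomNum (G.deleteEdges E') ≠ indepDomNum G ∧ E'.ncard = n}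

/-- The generalized friendship graph `F_{q,n}`: `n` cycles of length `q` meeting at a
single common vertex `none`.  The vertex `some (i, j)` is the `(j+1)`-st vertex of the
`i`-th cycle (the common vertex being its `0`-th vertex); consecutive vertices of each
cycle are adjacent and the common vertex is adjacent to the first (`j = 0`) and last
(`j = q - 2`) vertex of every cycle. -/
def genFriendshipGraph (q n : ℕ) : SimpleGraph (Option (Fin n × Fin (q - 1))) :=
  SimpleGraph.fromRel (fun x y =>
    (∃ i j, x = none ∧ y = some (i, j) ∧ ((j : ℕ) = 0 ∨ (j : ℕ) = q - 2)) ∨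
    (∃ i j k, x = some (i, j) ∧ y = some (i, k) ∧ (j : ℕ) + 1 = (k : ℕ)))

theorem genFriendship_adj_none (n : ℕ) (i : Fin n) (j : Fin 3) :
    (genFriendshipGraph 4 n).Adj none (some (i, j)) ↔ j = 0 ∨ j = 2 := by
  unfold genFriendshipGraph
  rw [SimpleGraph.fromRel_adj]
  constructor
  · rintro ⟨-, (⟨i', j', -, h, h2⟩ | ⟨_, _, _, h, -⟩) | (⟨_, _, h, -⟩ | ⟨_, _, _, -, h, -⟩)⟩
    · simp only [Option.some.injEq, Prod.mk.injEq] at h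
      obtain ⟨rfl, rfl⟩ := h
      fin_cases j <;> simp_all
    all_goals simp at h
  · intro h
    refine ⟨by simp, Or.inl (Or.inl ⟨i, j, rfl, rfl, ?_⟩)⟩
    rcases h with rfl | rfl <;> simp

theorem genFriendship_adj_some (n : ℕ) (i i' : Fin n) (j k : Fin 3) :
    (genFriendshipGraph 4 n).Adj (some (i, j)) (some (i', k)) ↔
      i = i' ∧ ((j : ℕ) + 1 = k ∨ (k : ℕ) + 1 = j) := by
  unfold genFriendshipGraph
  rw [SimpleGraph.fromRel_adj]
  constructor
  · rintro ⟨-, (⟨_, _, h, -⟩ | ⟨a, b, c, h, h2, h3⟩) | (⟨_, _, h, -⟩ | ⟨a, b, c, h, h2, h3⟩)⟩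
    · simp at h
    · simp only [Option.some.injEq, Prod.mk.injEq] at h h2
      obtain ⟨rfl, rfl⟩ := h
      obtain ⟨rfl, rfl⟩ := h2
      exact ⟨rfl, Or.inl h3⟩
    · simp at h
    · simp only [Option.some.injEq, Prod.mk.injEq] at h h2
      obtain ⟨rfl, rfl⟩ := h
      obtain ⟨rfl, rfl⟩ := h2
      exact ⟨rfl, Or.inr h3⟩
  · rintro ⟨rfl, h⟩
    refine ⟨?_, ?_⟩
    · intro h'
      simp only [Option.some.injEq, Prod.mk.injEq, true_and] at h'
      subst h'
      omega
    · rcases h with h | h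
      · exact Or.inl (Or.inr ⟨i, j, k, rfl, rfl, h⟩)
      · exact Or.inr (Or.inr ⟨i, k, j, rfl, rfl, h⟩)

theorem genFriendship_lower (n : ℕ) (S : Set (Option (Fin n × Fin 3)))
    (hS : IsIndepDomSet (genFriendshipGraph 4 n) S) : n + 1 ≤ S.ncard := by
  obtain ⟨hi, hd⟩ := hS
  have hf : ∀ i : Fin n, ∃ j : Fin 3, some (i, j) ∈ S := by
    intro i
    by_cases h : some (i, (1 : Fin 3)) ∈ S
    · exact ⟨1, h⟩
    · obtain ⟨u, hu, ha⟩ := hd _ h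
      rcases u with _ | ⟨i', j⟩
      · have := (genFriendship_adj_none n i 1).1 ha
        simp at this
      · obtain ⟨rfl, -⟩ := (genFriendship_adj_some n i' i j 1).1 ha
        exact ⟨j, hu⟩
  choose f hf using hf
  let g : Fin n → Option (Fin n × Fin 3) := fun i => some (i, f i)
  have hg : Function.Injective g := by
    intro a b h
    simp only [g, Option.some.injEq, Prod.mk.injEq] at h
    exact h.1
  have hx : ∃ x ∈ S, x ∉ Set.range g := by
    by_cases h : (none : Option (Fin n × Fin 3)) ∈ S
    · exact ⟨none, h, by simp [g]⟩
    · obtain ⟨u, hu, ha⟩ := hd _ h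
      rcases u with _ | ⟨i, j⟩
      · exact absurd hu h
      · have hj := (genFriendship_adj_none n i j).1 ha.symm
        -- the opposite neighbour of the centre also lies in `S`
        have key : ∃ k : Fin 3, k ≠ j ∧ some (i, k) ∈ S := by
          by_contra! hc
          have hk : ∃ k : Fin 3, k ≠ j ∧ (k = 0 ∨ k = 2) := by
            rcases hj with rfl | rfl
            · exact ⟨2, by decide, by decide⟩
            · exact ⟨0, by decide, by decide⟩
          obtain ⟨k, hkj, hk⟩ := hk
          obtain ⟨v, hv, hav⟩ := hd _ (hc k hkj)
          rcases v with _ | ⟨i', l⟩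
          · exact h hv
          · obtain ⟨rfl, hl⟩ := (genFriendship_adj_some n i' i l k).1 hav
            by_cases hlj : l = j
            · subst hlj
              rcases hj with rfl | rfl <;> rcases hk with rfl | rfl <;> simp at hl
            · exact hc l hlj hv
        obtain ⟨k, hkj, hk⟩ := key
        by_cases hfi : f i = j
        · refine ⟨_, hk, ?_⟩
          rintro ⟨a, ha'⟩
          simp only [g, Option.some.injEq, Prod.mk.injEq] at ha'
          obtain ⟨rfl, h2⟩ := ha'
          exact hkj (h2.symm.trans hfi)
        · refine ⟨_, hu, ?_⟩
          rintro ⟨a, ha'⟩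
          simp only [g, Option.some.injEq, Prod.mk.injEq] at ha'
          obtain ⟨rfl, h2⟩ := ha'
          exact hfi h2
  obtain ⟨x, hxS, hx⟩ := hx
  have hsub : insert x (Set.range g) ⊆ S := by
    rintro y (rfl | ⟨i, rfl⟩)
    · exact hxS
    · exact hf i
  have h1 := Set.ncard_le_ncard hsub (Set.toFinite S)
  rw [Set.ncard_insert_of_notMem hx (Set.toFinite _), ← Set.image_univ,
    Set.ncard_image_of_injective _ hg, Set.ncard_univ, Nat.card_fin] at h1
  exact h1

theorem genFriendship_upper (n : ℕ) :
    ∃ S : Set (Option (Fin n × Fin 3)),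
      IsIndepDomSet (genFriendshipGraph 4 n) S ∧ S.ncard = n + 1 := by
  let g : Fin n → Option (Fin n × Fin 3) := fun i => some (i, 1)
  have hg : Function.Injective g := by
    intro a b h
    simp only [g, Option.some.injEq, Prod.mk.injEq] at h
    exact h.1
  refine ⟨insert none (Set.range g), ⟨?_, ?_⟩, ?_⟩
  · rintro a (rfl | ⟨i, rfl⟩) b (rfl | ⟨i', rfl⟩) h
    · exact h.ne rfl
    · have := (genFriendship_adj_none n i' 1).1 h
      simp at this
    · have := (genFriendship_adj_none n i 1).1 h.symm
      simp at this
    · have := (genFriendship_adj_some n i i' 1 1).1 h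
      simp at this
  · intro v hv
    rcases v with _ | ⟨i, j⟩
    · simp at hv
    · by_cases hj : j = 1
      · subst hj
        exact absurd (Or.inr ⟨i, rfl⟩) hv
      · refine ⟨none, Or.inl rfl, (genFriendship_adj_none n i j).2 ?_⟩
        exact (by decide : ∀ j : Fin 3, j ≠ 1 → j = 0 ∨ j = 2) j hj
  · rw [Set.ncard_insert_of_notMem (by simp [g]) (Set.toFinite _), ← Set.image_univ,
      Set.ncard_image_of_injective _ hg, Set.ncard_univ, Nat.card_fin]

/-- For the generalized friendship graph `F_{4,n}` with `n ≥ 1`,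
`γᵢ(F_{4,n}) = n + 1`. -/
theorem indepDomNum_genFriendship_4 (n : ℕ) (hn : 1 ≤ n) :
    indepDomNum (genFriendshipGraph 4 n) = n + 1 := by
  unfold indepDomNum
  apply le_antisymm
  · exact Nat.sInf_le (genFriendship_upper n)
  · refine le_csInf ⟨_, genFriendship_upper n⟩ ?_
    rintro m ⟨S, hS, rfl⟩
    exact genFriendship_lower n S hS
end

section
/- For the generalized friendship graph F_{5,n} with n ≥ 1, consisting of n cycles of length 5 meeting at a common vertex, the independent domination number satisfies γ_i(F_{5,n}) = n + 1. -/
theorem gf_adj_some (n : ℕ) (i i' : Fin n) (j k : Fin 4) :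
    (genFriendshipGraph 5 n).Adj (some (i, j)) (some (i', k)) ↔
      i = i' ∧ ((j : ℕ) + 1 = k ∨ (k : ℕ) + 1 = j) := by
  unfold genFriendshipGraph
  rw [SimpleGraph.fromRel_adj]
  constructor
  · rintro ⟨-, (⟨_, _, h, -⟩ | ⟨a, b, c, h1, h2, h3⟩) | (⟨_, _, h, -⟩ | ⟨a, b, c, h1, h2, h3⟩)⟩
    · cases h
    · cases h1; cases h2; exact ⟨rfl, Or.inl h3⟩
    · cases h
    · cases h1; cases h2; exact ⟨rfl, Or.inr h3⟩
  · rintro ⟨rfl, h⟩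
    refine ⟨?_, ?_⟩
    · intro e
      cases e
      omega
    · rcases h with h | h
      · exact Or.inl (Or.inr ⟨_, _, _, rfl, rfl, h⟩)
      · exact Or.inr (Or.inr ⟨_, _, _, rfl, rfl, h⟩)

theorem gf_adj_none (n : ℕ) (i : Fin n) (j : Fin 4) :
    (genFriendshipGraph 5 n).Adj none (some (i, j)) ↔ ((j : ℕ) = 0 ∨ (j : ℕ) = 3) := by
  unfold genFriendshipGraph
  rw [SimpleGraph.fromRel_adj]
  constructor
  · rintro ⟨-, (⟨_, _, -, h, h'⟩ | ⟨a, b, c, h1, h2, h3⟩) | (⟨_, _, h, h', -⟩ | ⟨a, b, c, h1, h2, h3⟩)⟩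
    · cases h; exact h'
    · cases h1
    · cases h'
    · cases h2
  · intro h
    exact ⟨by simp, Or.inl (Or.inl ⟨_, _, rfl, rfl, h⟩)⟩

theorem gf_upper (n : ℕ) : ∃ S, IsIndepDomSet (genFriendshipGraph 5 n) S ∧ S.ncard = n + 1 := by
  let g : Option (Fin n) → Option (Fin n × Fin 4) := Option.map (fun i => (i, 1))
  have hg : Function.Injective g := by
    apply Option.map_injective
    intro a b h
    exact (Prod.ext_iff.1 h).1
  have hs : ∀ i, (some (i, 1) : Option (Fin n × Fin 4)) ∈ Set.range g := fun i => ⟨some i, rfl⟩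
  have hz : (none : Option (Fin n × Fin 4)) ∈ Set.range g := ⟨none, rfl⟩
  refine ⟨Set.range g, ⟨?_, ?_⟩, ?_⟩
  · rintro _ ⟨a, rfl⟩ _ ⟨b, rfl⟩
    rcases a with _ | a <;> rcases b with _ | b
    · exact SimpleGraph.irrefl _
    · intro h
      have := (gf_adj_none n b 1).1 h
      simp at this
    · intro h
      have := (gf_adj_none n a 1).1 h.symm
      simp at this
    · intro h
      have := (gf_adj_some n a b 1 1).1 h
      simp at this
  · rintro (_ | ⟨i, j⟩) hv
    · exact absurd hz hv
    · change Fin 4 at j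
      by_cases h : (j : ℕ) = 0 ∨ (j : ℕ) = 3
      · exact ⟨none, hz, (gf_adj_none n i j).2 h⟩
      · by_cases h1 : j = 1
        · subst h1
          exact absurd (hs i) hv
        · refine ⟨_, hs i, (gf_adj_some n i i 1 j).2 ⟨rfl, ?_⟩⟩
          have : (j : ℕ) ≠ 1 := fun e => h1 (Fin.ext e)
          left
          change 1 + 1 = (j : ℕ)
          omega
  · rw [Set.ncard_def, ← Set.image_univ, hg.encard_image, Set.encard_univ]
    simp

theorem gf_lower (n : ℕ) (hn : 1 ≤ n) (S : Set (Option (Fin n × Fin 4)))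
    (hS : IsIndepDomSet (genFriendshipGraph 5 n) S) : n + 1 ≤ S.ncard := by
  have key : ∀ i : Fin n, ∀ j : Fin 4, (none ∈ S → (j : ℕ) ≠ 0 ∧ (j : ℕ) ≠ 3) →
      ∃ k : Fin 4, some (i, k) ∈ S ∧ ((k : ℕ) = j ∨ (k : ℕ) + 1 = j ∨ (j : ℕ) + 1 = k) := by
    intro i j hj
    by_cases h : some (i, j) ∈ S
    · exact ⟨j, h, Or.inl rfl⟩
    · obtain ⟨u, hu, ha⟩ := hS.2 _ h
      rcases u with _ | ⟨i', k⟩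
      · have := (gf_adj_none n i j).1 ha
        have := hj hu
        omega
      · obtain ⟨rfl, hk⟩ := (gf_adj_some n i' i k j).1 ha
        exact ⟨k, hu, Or.inr hk⟩
  have h1 : ∀ i : Fin n, ∃ k : Fin 4, some (i, k) ∈ S := fun i =>
    let ⟨k, hk, _⟩ := key i 1 (fun _ => by decide)
    ⟨k, hk⟩
  choose f hf using h1
  have hex : ∃ x ∈ S, ∀ i, x ≠ some (i, f i) := by
    by_cases h : none ∈ S
    · exact ⟨none, h, fun i => by simp⟩
    · let z : Fin n := ⟨0, hn⟩
      have hne : ∀ j : Fin 4, ∃ j' : Fin 4, ∀ k : Fin 4,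
          ((k : ℕ) = j' ∨ (k : ℕ) + 1 = j' ∨ (j' : ℕ) + 1 = k) → k ≠ j := by decide
      obtain ⟨j', hj'⟩ := hne (f z)
      obtain ⟨k, hk, hk'⟩ := key z j' (fun h' => absurd h' h)
      refine ⟨_, hk, fun i e => ?_⟩
      have e' := Option.some.inj e
      have e1 : z = i := congrArg Prod.fst e'
      have e2 : k = f i := congrArg Prod.snd e'
      subst e1
      exact hj' k hk' e2
  obtain ⟨x, hx, hxf⟩ := hex
  let g : Option (Fin n) → Option (Fin n × Fin 4) := fun o => o.elim x (fun i => some (i, f i))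
  have hg : Function.Injective g := by
    rintro (_ | a) (_ | b) h
    · rfl
    · exact absurd h (hxf b)
    · exact absurd h.symm (hxf a)
    · exact congrArg some (congrArg Prod.fst (Option.some.inj h))
  have hsub : Set.range g ⊆ S := by
    rintro _ ⟨_ | a, rfl⟩
    · exact hx
    · exact hf a
  have hc : (Set.range g).ncard = n + 1 := by
    rw [Set.ncard_def, ← Set.image_univ, hg.encard_image, Set.encard_univ]
    simp
  rw [← hc]
  exact Set.ncard_le_ncard hsub (Set.toFinite S)

/-- For the generalized friendship graph `F_{5,n}` with `n ≥ 1`,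
`γᵢ(F_{5,n}) = n + 1`. -/
theorem indepDomNum_genFriendship_5 (n : ℕ) (hn : 1 ≤ n) :
    indepDomNum (genFriendshipGraph 5 n) = n + 1 := by
  refine le_antisymm (Nat.sInf_le (gf_upper n)) ?_
  refine le_csInf ⟨_, gf_upper n⟩ ?_
  rintro _ ⟨S, hS, rfl⟩
  exact gf_lower n hn S hS
end

section
/- For the generalized friendship graph F_{6,n} with n ≥ 1, consisting of n cycles of length 6 meeting at a common vertex, the independent domination number satisfies γ_i(F_{6,n}) = n + 1. -/
theorem gf6_adj (n : ℕ) (u : Option (Fin n × Fin (6 - 1))) (i : Fin n) (j : Fin (6 - 1)) :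
    (genFriendshipGraph 6 n).Adj u (some (i, j)) ↔
      (u = none ∧ ((j : ℕ) = 0 ∨ (j : ℕ) = 4)) ∨
      (∃ k : Fin (6 - 1), u = some (i, k) ∧ ((k : ℕ) + 1 = j ∨ (j : ℕ) + 1 = k)) := by
  unfold genFriendshipGraph
  rw [SimpleGraph.fromRel_adj]
  constructor
  · rintro ⟨-, (⟨a, b, h1, h2, h3⟩ | ⟨a, b, c, h1, h2, h3⟩) | (⟨a, b, h1, h2, h3⟩ | ⟨a, b, c, h1, h2, h3⟩)⟩
    · simp only [Option.some.injEq, Prod.mk.injEq] at h2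
      obtain ⟨rfl, rfl⟩ := h2
      exact Or.inl ⟨h1, h3⟩
    · simp only [Option.some.injEq, Prod.mk.injEq] at h2
      obtain ⟨rfl, rfl⟩ := h2
      exact Or.inr ⟨b, h1, Or.inl h3⟩
    · simp at h1
    · simp only [Option.some.injEq, Prod.mk.injEq] at h1
      obtain ⟨rfl, rfl⟩ := h1
      exact Or.inr ⟨c, h2, Or.inr h3⟩
  · rintro (⟨rfl, h⟩ | ⟨k, rfl, h⟩)
    · exact ⟨by simp, Or.inl (Or.inl ⟨i, j, rfl, rfl, h⟩)⟩
    · refine ⟨?_, ?_⟩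
      · intro e
        simp only [Option.some.injEq, Prod.mk.injEq] at e
        obtain ⟨-, rfl⟩ := e
        omega
      · rcases h with h | h
        · exact Or.inl (Or.inr ⟨i, k, j, rfl, rfl, h⟩)
        · exact Or.inr (Or.inr ⟨i, j, k, rfl, rfl, h⟩)

theorem gf6_dom {n : ℕ} {S : Set (Option (Fin n × Fin (6 - 1)))}
    (hS : IsIndepDomSet (genFriendshipGraph 6 n) S) (i : Fin n) (j : Fin (6 - 1))
    (h : none ∉ S ∨ ((j : ℕ) ≠ 0 ∧ (j : ℕ) ≠ 4)) :
    ∃ k : Fin (6 - 1), some (i, k) ∈ S ∧ ((k : ℕ) ≤ j + 1 ∧ (j : ℕ) ≤ k + 1) := by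
  by_cases hm : some (i, j) ∈ S
  · exact ⟨j, hm, by omega, by omega⟩
  · obtain ⟨u, hu, ha⟩ := hS.2 _ hm
    rw [gf6_adj] at ha
    rcases ha with ⟨rfl, h'⟩ | ⟨k, rfl, h'⟩
    · rcases h with h | h
      · exact absurd hu h
      · omega
    · exact ⟨k, hu, by omega, by omega⟩

theorem gf6_lower {n : ℕ} (hn : 1 ≤ n) {S : Set (Option (Fin n × Fin (6 - 1)))}
    (hS : IsIndepDomSet (genFriendshipGraph 6 n) S) : n + 1 ≤ S.ncard := by
  have h1 : ∀ i : Fin n, ∃ k : Fin (6 - 1), some (i, k) ∈ S := fun i => by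
    obtain ⟨k, hk, -⟩ := gf6_dom hS i ⟨2, by omega⟩ (Or.inr (by simp))
    exact ⟨k, hk⟩
  choose f hf using h1
  have h2 : ∃ x ∈ S, ∀ i, x ≠ some (i, f i) := by
    by_cases h0 : none ∈ S
    · exact ⟨none, h0, by simp⟩
    · obtain ⟨a, ha, ha', -⟩ := gf6_dom hS ⟨0, hn⟩ ⟨0, by omega⟩ (Or.inl h0)
      obtain ⟨b, hb, -, hb'⟩ := gf6_dom hS ⟨0, hn⟩ ⟨4, by omega⟩ (Or.inl h0)
      simp only at ha' hb'
      by_cases e : a = f ⟨0, hn⟩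
      · refine ⟨_, hb, ?_⟩
        intro i hi
        simp only [Option.some.injEq, Prod.mk.injEq] at hi
        obtain ⟨rfl, rfl⟩ := hi
        rw [← e] at hb'
        omega
      · refine ⟨_, ha, ?_⟩
        intro i hi
        simp only [Option.some.injEq, Prod.mk.injEq] at hi
        obtain ⟨rfl, h⟩ := hi
        exact e h
  obtain ⟨x, hx, hx'⟩ := h2
  have hsub : insert x (Set.range fun i => some (i, f i)) ⊆ S := by
    rintro y (rfl | ⟨i, rfl⟩)
    · exact hx
    · exact hf i
  refine le_trans ?_ (Set.ncard_le_ncard hsub (Set.toFinite _))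
  rw [Set.ncard_insert_of_notMem (by rintro ⟨i, hi⟩; exact hx' i hi.symm) (Set.toFinite _),
    ← Set.image_univ, Set.ncard_image_of_injective, Set.ncard_univ]
  · simp
  · intro a b h
    simp only [Option.some.injEq, Prod.mk.injEq] at h
    exact h.1

theorem gf6_upper (n : ℕ) : ∃ S : Set (Option (Fin n × Fin (6 - 1))),
    IsIndepDomSet (genFriendshipGraph 6 n) S ∧ S.ncard = n + 1 := by
  refine ⟨insert none (Set.range fun i => some (i, ⟨2, by omega⟩)), ⟨?_, ?_⟩, ?_⟩
  · rintro a ha b (rfl | ⟨i, rfl⟩) hab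
    · rcases ha with rfl | ⟨i, rfl⟩
      · exact hab.ne rfl
      · have := hab.symm
        rw [gf6_adj] at this
        simp at this
    · rw [gf6_adj] at hab
      rcases ha with rfl | ⟨i, rfl⟩
      · simp at hab
      · rcases hab with ⟨h, -⟩ | ⟨k, h, h'⟩
        · simp at h
        · simp only [Option.some.injEq, Prod.mk.injEq] at h
          obtain ⟨-, rfl⟩ := h
          simp at h'
  · rintro (_ | ⟨i, j⟩) hv
    · simp at hv
    · have hj : (j : ℕ) ≠ 2 := by
        intro h
        exact hv (Or.inr ⟨i, by simp only [Option.some.injEq, Prod.mk.injEq, true_and]; ext; exact h.symm⟩)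
      by_cases h : (j : ℕ) = 0 ∨ (j : ℕ) = 4
      · exact ⟨none, Or.inl rfl, (gf6_adj _ _ _ _).2 (Or.inl ⟨rfl, h⟩)⟩
      · refine ⟨_, Or.inr ⟨i, rfl⟩, (gf6_adj _ _ _ _).2 (Or.inr ⟨_, rfl, ?_⟩)⟩
        have := j.2
        simp only
        omega
  · rw [Set.ncard_insert_of_notMem (by simp) (Set.toFinite _),
      ← Set.image_univ, Set.ncard_image_of_injective, Set.ncard_univ]
    · simp
    · intro a b h
      simp only [Option.some.injEq, Prod.mk.injEq] at h
      exact h.1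

/-- For the generalized friendship graph `F_{6,n}` with `n ≥ 1`,
`γᵢ(F_{6,n}) = n + 1`. -/
theorem indepDomNum_genFriendship_6 (n : ℕ) (hn : 1 ≤ n) :
    indepDomNum (genFriendshipGraph 6 n) = n + 1 := by
  apply le_antisymm
  · exact Nat.sInf_le (gf6_upper n)
  · obtain ⟨S, hS, h⟩ := Nat.sInf_mem (s := {m | ∃ S : Set (Option (Fin n × Fin (6 - 1))),
      IsIndepDomSet (genFriendshipGraph 6 n) S ∧ S.ncard = m}) ⟨_, gf6_upper n⟩
    have := gf6_lower hn hS
    rw [h] at this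
    exact this
end

section
/- For the generalized friendship graph F_{4,n} with n ≥ 1, consisting of n cycles of length 4 meeting at a common vertex, the independent domination bondage number satisfies b_id(F_{4,n}) = 3. -/
namespace GF4

abbrev VV (n : ℕ) := Option (Fin n × Fin (4 - 1))

abbrev vA {n : ℕ} (i : Fin n) : VV n := some (i, ⟨0, by decide⟩)
abbrev vB {n : ℕ} (i : Fin n) : VV n := some (i, ⟨1, by decide⟩)
abbrev vC {n : ℕ} (i : Fin n) : VV n := some (i, ⟨2, by decide⟩)

lemma cases_vv {n : ℕ} (x : VV n) : x = none ∨ ∃ i, x = vA i ∨ x = vB i ∨ x = vC i := by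
  rcases x with _ | ⟨i, ⟨j, hj⟩⟩
  · simp
  · right
    refine ⟨i, ?_⟩
    have : j = 0 ∨ j = 1 ∨ j = 2 := by omega
    rcases this with rfl | rfl | rfl <;> simp

lemma adj0A {n : ℕ} (i : Fin n) : (genFriendshipGraph 4 n).Adj none (vA i) := by
  simp [genFriendshipGraph]
lemma adj0C {n : ℕ} (i : Fin n) : (genFriendshipGraph 4 n).Adj none (vC i) := by
  simp [genFriendshipGraph]
lemma adjBA {n : ℕ} (i : Fin n) : (genFriendshipGraph 4 n).Adj (vB i) (vA i) := by
  simp [genFriendshipGraph]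
lemma adjBC {n : ℕ} (i : Fin n) : (genFriendshipGraph 4 n).Adj (vB i) (vC i) := by
  simp [genFriendshipGraph]

lemma adj_A {n : ℕ} {i : Fin n} {x : VV n} (h : (genFriendshipGraph 4 n).Adj x (vA i)) :
    x = none ∨ x = vB i := by
  rcases cases_vv x with rfl | ⟨k, rfl | rfl | rfl⟩ <;> simp_all [genFriendshipGraph]
lemma adj_C {n : ℕ} {i : Fin n} {x : VV n} (h : (genFriendshipGraph 4 n).Adj x (vC i)) :
    x = none ∨ x = vB i := by
  rcases cases_vv x with rfl | ⟨k, rfl | rfl | rfl⟩ <;> simp_all [genFriendshipGraph]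
lemma adj_B {n : ℕ} {i : Fin n} {x : VV n} (h : (genFriendshipGraph 4 n).Adj x (vB i)) :
    x = vA i ∨ x = vC i := by
  rcases cases_vv x with rfl | ⟨k, rfl | rfl | rfl⟩ <;> simp_all [genFriendshipGraph]
lemma adj_0 {n : ℕ} {x : VV n} (h : (genFriendshipGraph 4 n).Adj x none) :
    ∃ i, x = vA i ∨ x = vC i := by
  rcases cases_vv x with rfl | ⟨k, rfl | rfl | rfl⟩ <;> simp_all [genFriendshipGraph]

/-- Counting lemma. -/
lemma count {n : ℕ} (S T : Set (VV n)) (j : Fin n → Fin (4 - 1))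
    (hS : ∀ i, some (i, j i) ∈ S) (hT : T ⊆ S) (hd : ∀ i, some (i, j i) ∉ T) :
    n + T.ncard ≤ S.ncard := by
  have h1 : (Set.range (fun i : Fin n => (some (i, j i) : VV n))).ncard = n := by
    rw [← Set.image_univ, Set.ncard_image_of_injective, Set.ncard_univ, Nat.card_fin]
    intro a b h
    simp at h
    exact h.1
  have h2 : Disjoint (Set.range (fun i : Fin n => (some (i, j i) : VV n))) T := by
    rw [Set.disjoint_left]
    rintro _ ⟨i, rfl⟩
    exact hd i
  calc n + T.ncard = (Set.range (fun i : Fin n => (some (i, j i) : VV n)) ∪ T).ncard := by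
        rw [Set.ncard_union_eq h2 (Set.toFinite _) (Set.toFinite _), h1]
    _ ≤ S.ncard := by
        apply Set.ncard_le_ncard _ (Set.toFinite _)
        apply Set.union_subset _ hT
        rintro _ ⟨i, rfl⟩
        exact hS i

lemma exists_cycle {n : ℕ} {H : SimpleGraph (VV n)} (hH : H ≤ genFriendshipGraph 4 n)
    {S : Set (VV n)} (hS : IsIndepDomSet H S) (i : Fin n) : ∃ j, some (i, j) ∈ S := by
  by_cases h : vB i ∈ S
  · exact ⟨_, h⟩
  · obtain ⟨u, hu, hadj⟩ := hS.2 _ h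
    rcases adj_B (hH hadj) with rfl | rfl <;> exact ⟨_, hu⟩

/-- Counting with a prescribed representative in one cycle. -/
lemma count' {n : ℕ} {H : SimpleGraph (VV n)} (hH : H ≤ genFriendshipGraph 4 n)
    {S : Set (VV n)} (hS : IsIndepDomSet H S) (i₀ : Fin n) (j₀ : Fin (4 - 1))
    (h0 : some (i₀, j₀) ∈ S) (T : Set (VV n)) (hT : T ⊆ S) (hd : some (i₀, j₀) ∉ T)
    (hT' : ∀ i j, some (i, j) ∈ T → i = i₀) : n + T.ncard ≤ S.ncard := by
  choose j hj using exists_cycle hH hS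
  apply count S T (fun i => if i = i₀ then j₀ else j i) _ hT
  · intro i hi
    have := hT' _ _ hi
    subst this
    simp at hi
    exact hd hi
  · intro i
    by_cases h : i = i₀
    · subst h; simpa using h0
    · simpa [h] using hj i

lemma lower {n : ℕ} {H : SimpleGraph (VV n)} (hH : H ≤ genFriendshipGraph 4 n)
    {S : Set (VV n)} (hS : IsIndepDomSet H S) : n + 1 ≤ S.ncard := by
  by_cases h0 : none ∈ S
  · choose j hj using exists_cycle hH hS
    have := count S {none} j hj (by simpa using h0) (by simp)
    simpa using this
  · have key : ∀ (i : Fin n) (j j' : Fin (4 - 1)), j ≠ j' → some (i, j) ∈ S → some (i, j') ∈ S →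
        n + 1 ≤ S.ncard := by
      intro i j j' hne h h'
      have := count' hH hS i j h {some (i, j')} (by simpa using h') (by simpa using hne)
        (by simp)
      simpa using this
    obtain ⟨u, hu, hadj⟩ := hS.2 _ h0
    obtain ⟨i, rfl | rfl⟩ := adj_0 (hH hadj)
    · by_cases hc : vC i ∈ S
      · exact key i _ _ (by decide) hu hc
      · obtain ⟨w, hw, hadj'⟩ := hS.2 _ hc
        rcases adj_C (hH hadj') with rfl | rfl
        · exact absurd hw h0
        · exact key i _ _ (by decide) hu hw
    · by_cases hc : vA i ∈ S
      · exact key i _ _ (by decide) hu hc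
      · obtain ⟨w, hw, hadj'⟩ := hS.2 _ hc
        rcases adj_A (hH hadj') with rfl | rfl
        · exact absurd hw h0
        · exact key i _ _ (by decide) hu hw

lemma num_eq {n : ℕ} {H : SimpleGraph (VV n)} (hH : H ≤ genFriendshipGraph 4 n)
    {S : Set (VV n)} (hS : IsIndepDomSet H S) (hc : S.ncard ≤ n + 1) :
    indepDomNum H = n + 1 := by
  have hmem : S.ncard ∈ {m | ∃ S : Set (VV n), IsIndepDomSet H S ∧ S.ncard = m} := ⟨S, hS, rfl⟩
  unfold indepDomNum
  apply le_antisymm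
  · exact (Nat.sInf_le hmem).trans hc
  · apply le_csInf ⟨_, hmem⟩
    rintro _ ⟨S', hS', rfl⟩
    exact lower hH hS'

lemma card_bound {n : ℕ} (x : VV n) (f : Fin n → VV n) :
    (insert x (Set.range f)).ncard ≤ n + 1 := by
  refine (Set.ncard_insert_le _ _).trans ?_
  have : (Set.range f).ncard ≤ n := by
    rw [← Set.image_univ]
    refine (Set.ncard_image_le (Set.toFinite _)).trans ?_
    simp
  omega

/-- Case 1: the centre together with all the middle vertices. -/
lemma case1 {n : ℕ} {H : SimpleGraph (VV n)} (hH : H ≤ genFriendshipGraph 4 n)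
    (hA : ∀ i, H.Adj none (vA i) ∨ H.Adj (vB i) (vA i))
    (hC : ∀ i, H.Adj none (vC i) ∨ H.Adj (vB i) (vC i)) :
    indepDomNum H = n + 1 := by
  apply num_eq hH (S := insert none (Set.range vB)) _ (card_bound _ _)
  constructor
  · rintro a (rfl | ⟨i, rfl⟩) b (rfl | ⟨k, rfl⟩) hab
    · exact H.loopless.irrefl _ hab
    · have := adj_B (hH hab); simp at this
    · have := adj_0 (hH hab); simp at this
    · have := adj_B (hH hab); simp at this
  · intro v hv
    rcases cases_vv v with rfl | ⟨k, rfl | rfl | rfl⟩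
    · simp at hv
    · rcases hA k with h | h
      · exact ⟨_, by simp, h⟩
      · exact ⟨_, by simp, h⟩
    · simp at hv
    · rcases hC k with h | h
      · exact ⟨_, by simp, h⟩
      · exact ⟨_, by simp, h⟩

/-- Case 2: both end vertices of one cycle with all other middle vertices. -/
lemma case2 {n : ℕ} {H : SimpleGraph (VV n)} (hH : H ≤ genFriendshipGraph 4 n) (i₀ : Fin n)
    (h0 : H.Adj (vA i₀) none ∨ H.Adj (vC i₀) none)
    (hb : H.Adj (vA i₀) (vB i₀) ∨ H.Adj (vC i₀) (vB i₀))
    (hr : ∀ i, i ≠ i₀ → H.Adj (vB i) (vA i) ∧ H.Adj (vB i) (vC i)) :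
    indepDomNum H = n + 1 := by
  have hmem : ∀ x : VV n, x ∈ insert (vC i₀) (Set.range fun i => if i = i₀ then vA i₀ else vB i)
      ↔ x = vC i₀ ∨ x = vA i₀ ∨ ∃ i, i ≠ i₀ ∧ x = vB i := by
    intro x
    constructor
    · rintro (rfl | ⟨i, rfl⟩)
      · simp
      · by_cases h : i = i₀ <;> simp [h]
    · rintro (rfl | rfl | ⟨i, h, rfl⟩)
      · simp
      · right; exact ⟨i₀, by simp⟩
      · right; exact ⟨i, by simp [h]⟩
  apply num_eq hH (S := insert (vC i₀) (Set.range fun i => if i = i₀ then vA i₀ else vB i)) _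
    (card_bound _ _)
  constructor
  · intro a ha b hb hab
    rw [hmem] at ha hb
    rcases hb with rfl | rfl | ⟨k, hk, rfl⟩
    · rcases adj_C (hH hab) with rfl | rfl <;> simp at ha
    · rcases adj_A (hH hab) with rfl | rfl <;> simp at ha
    · rcases adj_B (hH hab) with rfl | rfl <;> simp [hk] at ha
  · intro v hv
    simp only [hmem] at hv ⊢
    rcases cases_vv v with rfl | ⟨k, rfl | rfl | rfl⟩
    · rcases h0 with h | h
      · exact ⟨_, by simp, h⟩
      · exact ⟨_, by simp, h⟩
    · have hk : k ≠ i₀ := by rintro rfl; simp at hv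
      exact ⟨vB k, by simp [hk], (hr k hk).1⟩
    · have hk : k = i₀ := by by_contra hk; simp [hk] at hv
      subst hk
      rcases hb with h | h
      · exact ⟨_, by simp, h⟩
      · exact ⟨_, by simp, h⟩
    · have hk : k ≠ i₀ := by rintro rfl; simp at hv
      exact ⟨vB k, by simp [hk], (hr k hk).2⟩

lemma num_del {n : ℕ} (E : Set (Sym2 (VV n))) (hE : E.ncard ≤ 2) :
    indepDomNum ((genFriendshipGraph 4 n).deleteEdges E) = n + 1 := by
  have hle := (genFriendshipGraph 4 n).deleteEdges_le E
  have two : ∀ x y : Sym2 (VV n), x ≠ y → x ∈ E → y ∈ E → E = {x, y} := by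
    intro x y hxy hx hy
    symm
    apply Set.eq_of_subset_of_ncard_le
    · rintro z (rfl | rfl) <;> assumption
    · rw [Set.ncard_pair hxy]; exact hE
    · exact Set.toFinite _
  by_cases hA : ∀ i, ((genFriendshipGraph 4 n).deleteEdges E).Adj none (vA i) ∨
      ((genFriendshipGraph 4 n).deleteEdges E).Adj (vB i) (vA i)
  · by_cases hC : ∀ i, ((genFriendshipGraph 4 n).deleteEdges E).Adj none (vC i) ∨
        ((genFriendshipGraph 4 n).deleteEdges E).Adj (vB i) (vC i)
    · exact case1 hle hA hC
    · push Not at hC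
      obtain ⟨i, h1, h2⟩ := hC
      simp only [SimpleGraph.deleteEdges_adj, adj0C, adjBC, true_and, not_not] at h1 h2
      have hEq := two _ _ (by simp) h1 h2
      subst hEq
      apply case2 hle i
      · left; simp [SimpleGraph.deleteEdges_adj, (adj0A i).symm]
      · left; simp [SimpleGraph.deleteEdges_adj, (adjBA i).symm]
      · intro k hk
        simp [SimpleGraph.deleteEdges_adj, adjBA, adjBC, hk]
  · push Not at hA
    obtain ⟨i, h1, h2⟩ := hA
    simp only [SimpleGraph.deleteEdges_adj, adj0A, adjBA, true_and, not_not] at h1 h2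
    have hEq := two _ _ (by simp) h1 h2
    subst hEq
    apply case2 hle i
    · right; simp [SimpleGraph.deleteEdges_adj, (adj0C i).symm]
    · right; simp [SimpleGraph.deleteEdges_adj, (adjBC i).symm]
    · intro k hk
      simp [SimpleGraph.deleteEdges_adj, adjBA, adjBC, hk]

lemma num_G {n : ℕ} : indepDomNum (genFriendshipGraph 4 n) = n + 1 := by
  have := num_del (n := n) ∅ (by simp)
  simpa using this

abbrev E3 {n : ℕ} (i : Fin n) : Set (Sym2 (VV n)) :=
  {s(none, vA i), s(vB i, vA i), s(vB i, vC i)}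

lemma E3_card {n : ℕ} (i : Fin n) : (E3 i).ncard = 3 := by
  rw [Set.ncard_eq_three]
  exact ⟨_, _, _, by simp, by simp, by simp, rfl⟩

lemma num_E3 {n : ℕ} (i : Fin n) :
    indepDomNum ((genFriendshipGraph 4 n).deleteEdges (E3 i)) ≠ n + 1 := by
  intro h
  have hle := (genFriendshipGraph 4 n).deleteEdges_le (E3 i)
  have hne : {m | ∃ S : Set (VV n),
      IsIndepDomSet ((genFriendshipGraph 4 n).deleteEdges (E3 i)) S ∧ S.ncard = m}.Nonempty := by
    apply Nat.nonempty_of_pos_sInf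
    change 0 < indepDomNum _
    omega
  obtain ⟨S, hS, hc⟩ := Nat.sInf_mem hne
  change S.ncard = indepDomNum _ at hc
  have hA : vA i ∈ S := by
    by_contra hA
    obtain ⟨u, hu, hadj⟩ := hS.2 _ hA
    rcases adj_A (hle hadj) with rfl | rfl <;> simp [SimpleGraph.deleteEdges_adj] at hadj
  have hB : vB i ∈ S := by
    by_contra hB
    obtain ⟨u, hu, hadj⟩ := hS.2 _ hB
    rcases adj_B (hle hadj) with rfl | rfl <;> simp [SimpleGraph.deleteEdges_adj] at hadj
  have hC : vC i ∈ S ∨ none ∈ S := by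
    by_contra! hC
    obtain ⟨u, hu, hadj⟩ := hS.2 _ hC.1
    rcases adj_C (hle hadj) with rfl | rfl
    · exact hC.2 hu
    · simp [SimpleGraph.deleteEdges_adj] at hadj
  have : n + 2 ≤ S.ncard := by
    rcases hC with hC | hC
    · have := count' hle hS i _ hA {vB i, vC i} (by rintro z (rfl | rfl) <;> assumption)
        (by simp) (by rintro a b (h | h) <;> (simp at h; exact h.1))
      rwa [Set.ncard_pair (by simp)] at this
    · have := count' hle hS i _ hA {vB i, none} (by rintro z (rfl | rfl) <;> assumption)
        (by simp) (by
          rintro a b (h | h)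
          · simp at h; exact h.1
          · simp at h)
      rwa [Set.ncard_pair (by simp)] at this
  omega

end GF4

/-- For the generalized friendship graph `F_{4,n}` with `n ≥ 1`, `b_id(F_{4,n}) = 3`. -/
theorem idBondage_genFriendship_4 (n : ℕ) (hn : 1 ≤ n) :
    idBondage (genFriendshipGraph 4 n) = 3 := by
  have hmem : ∃ E' : Set (Sym2 (GF4.VV n)), E' ⊆ (genFriendshipGraph 4 n).edgeSet ∧
      E'.Nonempty ∧ indepDomNum ((genFriendshipGraph 4 n).deleteEdges E') ≠
        indepDomNum (genFriendshipGraph 4 n) ∧ E'.ncard = 3 := by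
    refine ⟨GF4.E3 ⟨0, hn⟩, ?_, ⟨_, Or.inl rfl⟩, ?_, GF4.E3_card _⟩
    · rintro z (rfl | rfl | rfl)
      · exact GF4.adj0A _
      · exact GF4.adjBA _
      · exact GF4.adjBC _
    · rw [GF4.num_G]
      exact GF4.num_E3 _
  apply le_antisymm
  · exact Nat.sInf_le hmem
  · apply le_csInf ⟨3, hmem⟩
    rintro _ ⟨E, -, -, hne, rfl⟩
    by_contra! hlt
    exact hne ((GF4.num_del E (by omega)).trans GF4.num_G.symm)
end

section
/- For the path graph P_n on n ≥ 2 vertices, the independent domination bondage number satisfies b_id(P_n) = 2 if n ≡ 1 (mod 3), and b_id(P_n) = 1 otherwise. -/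
theorem exists_ids {n : ℕ} (H : SimpleGraph (Fin n)) : ∃ S, IsIndepDomSet H S := by
  obtain ⟨S, hS⟩ := (Set.toFinite {S : Set (Fin n) | ∀ a ∈ S, ∀ b ∈ S, ¬ H.Adj a b}).exists_maximal
    ⟨∅, by simp⟩
  refine ⟨S, hS.1, fun v hv => ?_⟩
  by_contra! hcon
  have h1 : insert v S ∈ {S : Set (Fin n) | ∀ a ∈ S, ∀ b ∈ S, ¬ H.Adj a b} := by
    rintro a (rfl | ha) b (rfl | hb) hab
    · exact H.loopless.irrefl _ hab
    · exact hcon b hb hab.symm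
    · exact hcon a ha hab
    · exact hS.1 a ha b hb hab
  exact hv (hS.2 h1 (Set.subset_insert v S) (Set.mem_insert v S))

theorem path_adj {n : ℕ} (a b : Fin n) :
    (SimpleGraph.pathGraph n).Adj a b ↔ (a.val + 1 = b.val ∨ b.val + 1 = a.val) :=
  SimpleGraph.pathGraph_adj

theorem ids_lower {n j : ℕ} (hj : j ≤ n) (H : SimpleGraph (Fin n))
    (hH : H ≤ SimpleGraph.pathGraph n)
    (hiso : ∀ a b : Fin n, a.val < j → ¬ H.Adj a b) (S : Set (Fin n)) (hS : IsIndepDomSet H S) :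
    n + 2 * j ≤ 3 * S.ncard := by
  classical
  set T : Finset (Fin n) := S.toFinite.toFinset with hT
  have hcard : S.ncard = T.card := Set.ncard_eq_toFinset_card S
  have hmem : ∀ v, v ∈ T ↔ v ∈ S := fun v => by simp [hT]
  have hsmall : ∀ v : Fin n, v.val < j → v ∈ T := by
    intro v hv
    rw [hmem]
    by_contra h
    obtain ⟨u, _, hu⟩ := hS.2 v h
    exact hiso v u hv hu.symm
  have hA : (T.filter (fun v => v.val < j)).card = j := by
    have : (T.filter (fun v => v.val < j)) = (Finset.range j).attachFin
        (fun m hm => lt_of_lt_of_le (Finset.mem_range.1 hm) hj) := by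
      ext v
      simp only [Finset.mem_filter, Finset.mem_attachFin, Finset.mem_range]
      exact ⟨fun h => h.2, fun h => ⟨hsmall v h, h⟩⟩
    rw [this]; simp
  have hsplit := Finset.card_filter_add_card_filter_not (s := T) (fun v => v.val < j)
  have hB : Finset.Ico j n ⊆ (T.filter (fun v => ¬ v.val < j)).biUnion
      (fun v => {v.val - 1, v.val, v.val + 1}) := by
    intro m hm
    rw [Finset.mem_Ico] at hm
    rw [Finset.mem_biUnion]
    by_cases h : (⟨m, hm.2⟩ : Fin n) ∈ S
    · exact ⟨⟨m, hm.2⟩, by simp [hmem, h, hm.1], by simp⟩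
    · obtain ⟨u, hu, hadj⟩ := hS.2 _ h
      have h1 := (path_adj _ _).1 (hH hadj)
      refine ⟨u, ?_, ?_⟩
      · rw [Finset.mem_filter, hmem]
        exact ⟨hu, fun hlt => hiso u _ hlt hadj⟩
      · simp only [Finset.mem_insert, Finset.mem_singleton]
        simp only at h1
        omega
  have hC := (Finset.card_le_card hB).trans
    (Finset.card_biUnion_le_card_mul _ _ 3 (fun v _ => Finset.card_le_three))
  rw [Nat.card_Ico] at hC
  omega

theorem num_lower {n j : ℕ} (hj : j ≤ n) (H : SimpleGraph (Fin n))
    (hH : H ≤ SimpleGraph.pathGraph n)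
    (hiso : ∀ a b : Fin n, a.val < j → ¬ H.Adj a b) : n + 2 * j ≤ 3 * indepDomNum H := by
  obtain ⟨S0, hS0⟩ := exists_ids H
  have hne : {m | ∃ S : Set (Fin n), IsIndepDomSet H S ∧ S.ncard = m}.Nonempty := ⟨_, S0, hS0, rfl⟩
  obtain ⟨S, hS, hc⟩ := Nat.sInf_mem hne
  unfold indepDomNum
  rw [← hc]
  exact ids_lower hj H hH hiso S hS

/-- domination reduced to arithmetic -/
theorem ids_of {n : ℕ} (H : SimpleGraph (Fin n)) (P : ℕ → Prop) (R : ℕ → ℕ → Prop)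
    (hR : ∀ a b : Fin n, H.Adj a b ↔ R a.val b.val)
    (h1 : ∀ a < n, ∀ b < n, P a → P b → ¬ R a b)
    (h2 : ∀ v < n, ¬ P v → (v + 1 < n ∧ P (v + 1) ∧ R (v + 1) v) ∨
      (1 ≤ v ∧ P (v - 1) ∧ R (v - 1) v)) :
    IsIndepDomSet H {v | P v.val} := by
  refine ⟨fun a ha b hb hab => h1 a a.2 b b.2 ha hb ((hR a b).1 hab), fun v hv => ?_⟩
  rcases h2 v v.2 hv with ⟨h, hP, hr⟩ | ⟨h, hP, hr⟩
  · exact ⟨⟨v.val + 1, h⟩, hP, (hR _ _).2 hr⟩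
  · exact ⟨⟨v.val - 1, by omega⟩, hP, (hR _ _).2 hr⟩

theorem num_upper {n k c : ℕ} (H : SimpleGraph (Fin n)) (P : ℕ → Prop) (R : ℕ → ℕ → Prop)
    (hR : ∀ a b : Fin n, H.Adj a b ↔ R a.val b.val)
    (h1 : ∀ a < n, ∀ b < n, P a → P b → ¬ R a b)
    (h2 : ∀ v < n, ¬ P v → (v + 1 < n ∧ P (v + 1) ∧ R (v + 1) v) ∨
      (1 ≤ v ∧ P (v - 1) ∧ R (v - 1) v))
    (hlt : ∀ v < n, P v → (v + c) / 3 < k)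
    (hinj : ∀ v < n, ∀ w < n, P v → P w → (v + c) / 3 = (w + c) / 3 → v = w) :
    indepDomNum H ≤ k := by
  have hS := ids_of H P R hR h1 h2
  have hle : indepDomNum H ≤ ({v : Fin n | P v.val}).ncard := Nat.sInf_le ⟨_, hS, rfl⟩
  refine hle.trans ?_
  have : ({v : Fin n | P v.val}).ncard ≤ (↑(Finset.range k) : Set ℕ).ncard := by
    refine Set.ncard_le_ncard_of_injOn (fun v => (v.val + c) / 3) ?_ ?_ (Finset.finite_toSet _)
    · intro v hv
      simpa using hlt v v.2 hv
    · intro v hv w hw h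
      exact Fin.ext (hinj v v.2 w w.2 hv hw h)
  simpa [Set.ncard_coe_finset] using this

theorem path_upper (n : ℕ) : indepDomNum (SimpleGraph.pathGraph n) ≤ (n + 2) / 3 := by
  by_cases h : n % 3 = 0
  · refine num_upper (c := 0) _ (fun v => v % 3 = 1)
      (fun a b => a + 1 = b ∨ b + 1 = a) path_adj ?_ ?_ ?_ ?_ <;> intros <;> omega
  · refine num_upper (c := 0) _ (fun v => v % 3 = 0)
      (fun a b => a + 1 = b ∨ b + 1 = a) path_adj ?_ ?_ ?_ ?_ <;> intros <;> omega

theorem del_adj {n : ℕ} (u v : Fin n) (huv : u.val + 1 = v.val) (a b : Fin n) :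
    ((SimpleGraph.pathGraph n).deleteEdges {s(u, v)}).Adj a b ↔
      (a.val + 1 = b.val ∧ a.val ≠ u.val ∨ b.val + 1 = a.val ∧ b.val ≠ u.val) := by
  rw [SimpleGraph.deleteEdges_adj, path_adj]
  simp only [Set.mem_singleton_iff, Sym2.eq_iff, Fin.ext_iff]
  omega

theorem del_upper {n : ℕ} (hn : n % 3 = 1) (u v : Fin n) (huv : u.val + 1 = v.val) :
    indepDomNum ((SimpleGraph.pathGraph n).deleteEdges {s(u, v)}) ≤ (n + 2) / 3 := by
  have hadj := del_adj u v huv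
  have hv := v.2
  generalize u.val = m at *
  generalize v.val = m' at *
  subst huv
  have h3 : m % 3 = 2 ∨ m % 3 = 0 ∨ m % 3 = 1 := by omega
  rcases h3 with h | h | h
  · refine num_upper (c := 0) _ (fun v => (v ≤ m ∧ v % 3 = 1) ∨ (m < v ∧ v % 3 = 0))
      (fun a b => a + 1 = b ∧ a ≠ m ∨ b + 1 = a ∧ b ≠ m) hadj ?_ ?_ ?_ ?_ <;> intros <;> omega
  · refine num_upper (c := 2) _ (fun v => (v ≤ m ∧ v % 3 = 0) ∨ (m < v ∧ v % 3 = 2))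
      (fun a b => a + 1 = b ∧ a ≠ m ∨ b + 1 = a ∧ b ≠ m) hadj ?_ ?_ ?_ ?_ <;> intros <;> omega
  · refine num_upper (c := 2) _ (fun v => (v ≤ m ∧ v % 3 = 0) ∨ (m < v ∧ v % 3 = 2))
      (fun a b => a + 1 = b ∧ a ≠ m ∨ b + 1 = a ∧ b ≠ m) hadj ?_ ?_ ?_ ?_ <;> intros <;> omega

theorem path_num (n : ℕ) : indepDomNum (SimpleGraph.pathGraph n) = (n + 2) / 3 := by
  have h1 := path_upper n
  have h2 := num_lower (j := 0) (Nat.zero_le n) (SimpleGraph.pathGraph n) le_rfl (by simp)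
  omega

theorem del_eq {n : ℕ} (hn : n % 3 = 1) (e : Sym2 (Fin n))
    (he : e ∈ (SimpleGraph.pathGraph n).edgeSet) :
    indepDomNum ((SimpleGraph.pathGraph n).deleteEdges {e}) = (n + 2) / 3 := by
  have hl := num_lower (j := 0) (Nat.zero_le n) ((SimpleGraph.pathGraph n).deleteEdges {e})
    (SimpleGraph.deleteEdges_le _) (by simp)
  have hu : indepDomNum ((SimpleGraph.pathGraph n).deleteEdges {e}) ≤ (n + 2) / 3 := by
    induction e using Sym2.ind with
    | _ u v =>
      rw [SimpleGraph.mem_edgeSet, path_adj] at he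
      rcases he with h | h
      · exact del_upper hn u v h
      · rw [Sym2.eq_swap]; exact del_upper hn v u h
  omega

/-- For the path `P_n` on `n ≥ 2` vertices, `b_id(P_n) = 2` if `n ≡ 1 (mod 3)`
and `b_id(P_n) = 1` otherwise. -/
theorem idBondage_path (n : ℕ) (hn : 2 ≤ n) :
    idBondage (SimpleGraph.pathGraph n) = if n % 3 = 1 then 2 else 1 := by
  unfold idBondage
  have hpos : ∀ E' : Set (Sym2 (Fin n)), E'.Nonempty → 1 ≤ E'.ncard := fun E' h =>
    (Set.ncard_pos (Set.toFinite _)).2 h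
  split_ifs with h
  · refine IsLeast.csInf_eq ⟨?_, ?_⟩
    · refine ⟨{s(⟨0, by omega⟩, ⟨1, by omega⟩), s(⟨1, by omega⟩, ⟨2, by omega⟩)}, ?_, ?_, ?_, ?_⟩
      · rintro e (rfl | rfl) <;> rw [SimpleGraph.mem_edgeSet, path_adj] <;> simp
      · simp
      · have := num_lower (j := 2) hn ((SimpleGraph.pathGraph n).deleteEdges
          {s(⟨0, by omega⟩, ⟨1, by omega⟩), s(⟨1, by omega⟩, ⟨2, by omega⟩)})
          (SimpleGraph.deleteEdges_le _) (by
            intro a b ha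
            rw [SimpleGraph.deleteEdges_adj, path_adj]
            simp only [Set.mem_insert_iff, Set.mem_singleton_iff, Sym2.eq_iff, Fin.ext_iff]
            omega)
        rw [path_num]
        omega
      · apply Set.ncard_pair
        simp [Fin.ext_iff]
    · rintro m ⟨E', hE, hne, hnum, rfl⟩
      have h1 := hpos E' hne
      by_contra hlt
      obtain ⟨e, rfl⟩ := Set.ncard_eq_one.1 (show E'.ncard = 1 by omega)
      rw [path_num, del_eq h e (hE rfl)] at hnum
      exact hnum rfl
  · refine IsLeast.csInf_eq ⟨?_, ?_⟩
    · refine ⟨{s(⟨0, by omega⟩, ⟨1, by omega⟩)}, ?_, ?_, ?_, ?_⟩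
      · rintro e rfl; rw [SimpleGraph.mem_edgeSet, path_adj]; simp
      · simp
      · have := num_lower (j := 1) (by omega) ((SimpleGraph.pathGraph n).deleteEdges
          {s(⟨0, by omega⟩, ⟨1, by omega⟩)})
          (SimpleGraph.deleteEdges_le _) (by
            intro a b ha
            rw [SimpleGraph.deleteEdges_adj, path_adj]
            simp only [Set.mem_singleton_iff, Sym2.eq_iff, Fin.ext_iff]
            omega)
        rw [path_num]
        omega
      · exact Set.ncard_singleton _
    · rintro m ⟨E', hE, hne, hnum, rfl⟩
      exact hpos E' hne
end

section
/- For the cycle graph C_n on n ≥ 3 vertices, the independent domination bondage number satisfies b_id(C_n) = 3 if n ≡ 1 (mod 3), and b_id(C_n) = 2 otherwise. -/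
namespace IdB

theorem modh {x n : ℕ} (h : x < 2 * n) : (x < n ∧ x % n = x) ∨ (n ≤ x ∧ x % n = x - n) := by
  rcases lt_or_ge x n with h1 | h1
  · exact Or.inl ⟨h1, Nat.mod_eq_of_lt h1⟩
  · exact Or.inr ⟨h1, by rw [Nat.mod_eq_sub_mod h1, Nat.mod_eq_of_lt (by omega)]⟩

theorem cadj {n : ℕ} (hn : 3 ≤ n) (u v : Fin n) :
    (SimpleGraph.cycleGraph n).Adj u v ↔
      (u.val + 1) % n = v.val ∨ (v.val + 1) % n = u.val := by
  rw [SimpleGraph.cycleGraph_adj', Fin.sub_def, Fin.sub_def]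
  have hu := u.2
  have hv := v.2
  simp only
  rcases modh (x := n - v.val + u.val) (n := n) (by omega) with h | h <;>
  rcases modh (x := n - u.val + v.val) (n := n) (by omega) with h' | h' <;>
  rcases modh (x := u.val + 1) (n := n) (by omega) with h1 | h1 <;>
  rcases modh (x := v.val + 1) (n := n) (by omega) with h2 | h2 <;>
  omega

/-- rotated enumeration of the vertices -/
def p {n : ℕ} (c : Fin n) (i : ℕ) : Fin n :=
  ⟨(c.val + i) % n, Nat.mod_lt _ (by have := c.2; omega)⟩

theorem p_inj {n : ℕ} (c : Fin n) {i j : ℕ} (hi : i < n) (hj : j < n) (h : p c i = p c j) :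
    i = j := by
  have hc := c.2
  have h := congrArg Fin.val h
  simp only [p] at h
  rcases modh (x := c.val + i) (n := n) (by omega) with h1 | h1 <;>
  rcases modh (x := c.val + j) (n := n) (by omega) with h2 | h2 <;> omega

theorem p_surj {n : ℕ} (c v : Fin n) : ∃ i, i < n ∧ p c i = v := by
  have hc := c.2
  have hv := v.2
  rcases le_or_gt c.val v.val with h | h
  · refine ⟨v.val - c.val, by omega, ?_⟩
    ext
    simp only [p]
    rcases modh (x := c.val + (v.val - c.val)) (n := n) (by omega) with h1 | h1 <;> omega
  · refine ⟨v.val + n - c.val, by omega, ?_⟩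
    ext
    simp only [p]
    rcases modh (x := c.val + (v.val + n - c.val)) (n := n) (by omega) with h1 | h1 <;> omega

theorem p_adj {n : ℕ} (hn : 3 ≤ n) (c : Fin n) {i j : ℕ} (hij : i < j) (hj : j < n) :
    (SimpleGraph.cycleGraph n).Adj (p c i) (p c j) ↔ (j = i + 1 ∨ (i = 0 ∧ j = n - 1)) := by
  have hc := c.2
  rw [cadj hn]
  simp only [p]
  rcases modh (x := c.val + i) (n := n) (by omega) with ⟨h1, e1⟩ | ⟨h1, e1⟩ <;>
  rcases modh (x := c.val + j) (n := n) (by omega) with ⟨h2, e2⟩ | ⟨h2, e2⟩ <;>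
  rw [e1, e2]
  · rcases modh (x := c.val + i + 1) (n := n) (by omega) with h3 | h3 <;>
    rcases modh (x := c.val + j + 1) (n := n) (by omega) with h4 | h4 <;> omega
  · rcases modh (x := c.val + i + 1) (n := n) (by omega) with h3 | h3 <;>
    rcases modh (x := c.val + j - n + 1) (n := n) (by omega) with h4 | h4 <;> omega
  · omega
  · rcases modh (x := c.val + i - n + 1) (n := n) (by omega) with h3 | h3 <;>
    rcases modh (x := c.val + j - n + 1) (n := n) (by omega) with h4 | h4 <;> omega

theorem path_dom (m i : ℕ) (hi : i < m) (h : ¬ (i % 3 = 1 ∨ (i + 1 = m ∧ m % 3 = 1))) :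
    (i + 1 < m ∧ (i + 1) % 3 = 1) ∨ (1 ≤ i ∧ (i - 1) % 3 = 1) := by
  have h1 : i % 3 ≠ 1 := fun h' => h (Or.inl h')
  have h2 : i + 1 = m → m % 3 ≠ 1 := fun h' h'' => h (Or.inr ⟨h', h''⟩)
  clear h
  have : i % 3 = 0 ∨ i % 3 = 2 := by omega
  rcases this with h3 | h3
  · left
    omega
  · right
    omega

theorem upper {n : ℕ} (hn : 3 ≤ n) (H : SimpleGraph (Fin n)) (c : Fin n) (a : ℕ)
    (ha : 1 ≤ a) (han : a ≤ n)
    (h1 : ∀ i, i + 1 < n → i + 1 ≠ a → H.Adj (p c i) (p c (i + 1)))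
    (h2 : ∀ i j, i < j → j < n → H.Adj (p c i) (p c j) →
      (j = i + 1 ∧ j ≠ a) ∨ (i = 0 ∧ j = n - 1 ∧ a = n)) :
    ∃ S, IsIndepDomSet H S ∧ S.ncard ≤ (a + 2) / 3 + (n - a + 2) / 3 := by
  let T : ℕ → Prop := fun i => (i < a ∧ (i % 3 = 1 ∨ (i + 1 = a ∧ a % 3 = 1))) ∨
    (a ≤ i ∧ i < n ∧ ((i - a) % 3 = 1 ∨ (i + 1 = n ∧ (n - a) % 3 = 1)))
  have hT : ∀ i, T i ↔ (i < a ∧ (i % 3 = 1 ∨ (i + 1 = a ∧ a % 3 = 1))) ∨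
    (a ≤ i ∧ i < n ∧ ((i - a) % 3 = 1 ∨ (i + 1 = n ∧ (n - a) % 3 = 1))) := fun i => Iff.rfl
  clear_value T
  have key : ∀ i j, T i → T j → i < j → j < n → ¬ H.Adj (p c i) (p c j) := by
    intro i j hi hj hij hjn hadj
    rw [hT] at hi hj
    have := h2 i j hij hjn hadj
    omega
  refine ⟨p c '' {i | i < n ∧ T i}, ⟨?_, ?_⟩, ?_⟩
  · rintro _ ⟨i, ⟨hi, hi'⟩, rfl⟩ _ ⟨j, ⟨hj, hj'⟩, rfl⟩ hadj
    rcases lt_trichotomy i j with h | h | h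
    · exact key i j hi' hj' h hj hadj
    · subst h
      exact H.irrefl hadj
    · exact key j i hj' hi' h hi hadj.symm
  · intro v hv
    obtain ⟨i, hi, rfl⟩ := p_surj c v
    have hTi : ¬ T i := fun h => hv ⟨i, ⟨hi, h⟩, rfl⟩
    have : (i + 1 < n ∧ i + 1 ≠ a ∧ T (i + 1)) ∨ (1 ≤ i ∧ i ≠ a ∧ T (i - 1)) := by
      rw [hT] at hTi
      rw [hT, hT]
      rcases lt_or_ge i a with hia | hia
      · have hq := path_dom a i hia (fun h => hTi (Or.inl ⟨hia, h⟩))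
        clear hTi h1 h2 key hv hT
        rcases hq with ⟨hq1, hq2⟩ | ⟨hq1, hq2⟩
        · exact Or.inl ⟨by omega, by omega, Or.inl ⟨hq1, Or.inl hq2⟩⟩
        · exact Or.inr ⟨hq1, by omega, Or.inl ⟨by omega, Or.inl hq2⟩⟩
      · have hq := path_dom (n - a) (i - a) (by clear hTi; omega) (fun h => hTi (Or.inr ⟨hia, hi, by
          rcases h with h | ⟨h, h'⟩
          · exact Or.inl h
          · exact Or.inr ⟨by clear hTi; omega, h'⟩⟩))
        clear hTi h1 h2 key hv hT
        rcases hq with ⟨hq1, hq2⟩ | ⟨hq1, hq2⟩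
        · exact Or.inl ⟨by omega, by omega, Or.inr ⟨by omega, by omega, Or.inl (by
            rwa [show i + 1 - a = i - a + 1 by omega])⟩⟩
        · exact Or.inr ⟨by omega, by omega, Or.inr ⟨by omega, by omega, Or.inl (by
            rwa [show i - 1 - a = i - a - 1 by omega])⟩⟩
    rcases this with ⟨h3, h4, h5⟩ | ⟨h3, h4, h5⟩
    · exact ⟨_, ⟨i + 1, ⟨h3, h5⟩, rfl⟩, (h1 i h3 h4).symm⟩
    · refine ⟨_, ⟨i - 1, ⟨by omega, h5⟩, rfl⟩, ?_⟩
      have := h1 (i - 1) (by omega) (by omega)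
      rwa [Nat.sub_add_cancel h3] at this
  · let F : Finset ℕ := (Finset.range ((a + 2) / 3)).image (fun k => min (3 * k + 1) (a - 1)) ∪
      (Finset.range ((n - a + 2) / 3)).image (fun k => a + min (3 * k + 1) (n - a - 1))
    have hF : F.card ≤ (a + 2) / 3 + (n - a + 2) / 3 := by
      refine (Finset.card_union_le _ _).trans (add_le_add ?_ ?_)
      · exact Finset.card_image_le.trans (by simp)
      · exact Finset.card_image_le.trans (by simp)
    have hsub : {i | i < n ∧ T i} ⊆ (F : Set ℕ) := by
      rintro i ⟨hi, hi'⟩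
      rw [hT] at hi'
      simp only [F, Finset.coe_union, Finset.coe_image, Set.mem_union, Set.mem_image,
        Finset.coe_range, Set.mem_Iio]
      rcases hi' with h | h
      · exact Or.inl ⟨i / 3, by omega, by omega⟩
      · exact Or.inr ⟨(i - a) / 3, by omega, by omega⟩
    have hfin : Set.Finite {i | i < n ∧ T i} := F.finite_toSet.subset hsub
    calc _ ≤ _ := Set.ncard_image_le hfin
      _ ≤ (F : Set ℕ).ncard := Set.ncard_le_ncard hsub F.finite_toSet
      _ = F.card := Set.ncard_coe_finset F
      _ ≤ _ := hF

theorem lower {n : ℕ} (hn : 3 ≤ n) (H : SimpleGraph (Fin n)) (hH : H ≤ SimpleGraph.cycleGraph n)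
    (I : Finset (Fin n)) (hI : ∀ u ∈ I, ∀ v, ¬ H.Adj v u) (S : Set (Fin n))
    (hS : IsIndepDomSet H S) : n + 2 * I.card ≤ 3 * S.ncard := by
  classical
  let F := S.toFinset
  have hF : S.ncard = F.card := Set.ncard_eq_toFinset_card' S
  have hIF : I ⊆ F := by
    intro u hu
    by_contra hc
    obtain ⟨w, _, hw⟩ := hS.2 u (by simpa [F] using hc)
    exact hI u hu w hw
  have hcov : (Finset.univ : Finset (Fin n)) ⊆
      I ∪ (F \ I).biUnion (fun u => {u, p u 1, p u (n - 1)}) := by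
    intro v _
    simp only [Finset.mem_union, Finset.mem_biUnion, Finset.mem_sdiff, Finset.mem_insert,
      Finset.mem_singleton]
    by_cases hv : v ∈ I
    · exact Or.inl hv
    right
    by_cases hvS : v ∈ S
    · exact ⟨v, ⟨by simpa [F] using hvS, hv⟩, Or.inl rfl⟩
    obtain ⟨u, huS, hu⟩ := hS.2 v hvS
    refine ⟨u, ⟨by simpa [F] using huS, fun h => hI u h v hu.symm⟩, Or.inr ?_⟩
    have := (cadj hn u v).1 (hH hu)
    have h1 := u.2
    have h2 := v.2
    rcases this with h | h
    · left
      ext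
      simp only [p]
      exact h.symm
    · right
      ext
      simp only [p]
      rcases modh (x := v.val + 1) (n := n) (by omega) with h3 | h3 <;>
      rcases modh (x := u.val + (n - 1)) (n := n) (by omega) with h4 | h4 <;> omega
  have hc := Finset.card_le_card hcov
  have hb : ((F \ I).biUnion (fun u => ({u, p u 1, p u (n - 1)} : Finset (Fin n)))).card
      ≤ (F \ I).card * 3 := Finset.card_biUnion_le_card_mul _ _ _ (fun u _ => Finset.card_le_three)
  have hu := Finset.card_union_le I
    ((F \ I).biUnion (fun u => ({u, p u 1, p u (n - 1)} : Finset (Fin n))))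
  have hd := Finset.card_sdiff_of_subset hIF
  have hle := Finset.card_le_card hIF
  rw [Finset.card_univ, Fintype.card_fin] at hc
  omega

theorem exists_ids {n : ℕ} (hn : 3 ≤ n) (H : SimpleGraph (Fin n)) :
    ∃ S, IsIndepDomSet H S := by
  obtain ⟨S, hS⟩ := (Set.toFinite {S : Set (Fin n) | ∀ a ∈ S, ∀ b ∈ S, ¬ H.Adj a b}).exists_maximal
    ⟨∅, by simp⟩
  refine ⟨S, hS.1, fun v hv => ?_⟩
  by_contra hc
  push Not at hc
  have : insert v S ∈ {S : Set (Fin n) | ∀ a ∈ S, ∀ b ∈ S, ¬ H.Adj a b} := by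
    rintro a (rfl | ha) b (rfl | hb) hab
    · exact H.irrefl hab
    · exact hc b hb hab.symm
    · exact hc a ha hab
    · exact hS.1 a ha b hb hab
  exact hv (hS.2 this (Set.subset_insert v S) (Set.mem_insert v S))

theorem num_lower {n : ℕ} (hn : 3 ≤ n) (H : SimpleGraph (Fin n))
    (hH : H ≤ SimpleGraph.cycleGraph n)
    (I : Finset (Fin n)) (hI : ∀ u ∈ I, ∀ v, ¬ H.Adj v u) :
    n + 2 * I.card ≤ 3 * indepDomNum H := by
  obtain ⟨S0, hS0⟩ := exists_ids hn H
  have : indepDomNum H ∈ {m | ∃ S : Set (Fin n), IsIndepDomSet H S ∧ S.ncard = m} :=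
    Nat.sInf_mem (s := {m | ∃ S : Set (Fin n), IsIndepDomSet H S ∧ S.ncard = m})
      ⟨_, S0, hS0, rfl⟩
  obtain ⟨S, hS, h⟩ := this
  rw [← h]
  exact lower hn H hH I hI S hS

theorem num_upper {n m : ℕ} (H : SimpleGraph (Fin n))
    (h : ∃ S, IsIndepDomSet H S ∧ S.ncard ≤ m) : indepDomNum H ≤ m := by
  obtain ⟨S, hS, h⟩ := h
  have h' : indepDomNum H ≤ S.ncard :=
    Nat.sInf_le (s := {m | ∃ S : Set (Fin n), IsIndepDomSet H S ∧ S.ncard = m}) ⟨S, hS, rfl⟩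
  exact h'.trans h

theorem num_eq {n : ℕ} (hn : 3 ≤ n) (H : SimpleGraph (Fin n))
    (hH : H ≤ SimpleGraph.cycleGraph n)
    (h : ∃ S, IsIndepDomSet H S ∧ S.ncard ≤ (n + 2) / 3) : indepDomNum H = (n + 2) / 3 := by
  have h1 := num_lower hn H hH ∅ (by simp)
  have h2 := num_upper H h
  simp at h1
  omega

theorem num_cycle {n : ℕ} (hn : 3 ≤ n) :
    indepDomNum (SimpleGraph.cycleGraph n) = (n + 2) / 3 := by
  refine num_eq hn _ le_rfl ?_
  have := upper hn (SimpleGraph.cycleGraph n) ⟨0, by omega⟩ n (by omega) le_rfl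
    (fun i h _ => (p_adj hn _ (by omega) h).2 (Or.inl rfl))
    (fun i j h hj hadj => by have := (p_adj hn _ h hj).1 hadj; omega)
  obtain ⟨S, hS, h⟩ := this
  exact ⟨S, hS, by omega⟩

theorem edge_form {n : ℕ} (hn : 3 ≤ n) (e : Sym2 (Fin n))
    (he : e ∈ (SimpleGraph.cycleGraph n).edgeSet) : ∃ x, e = s(x, p x 1) := by
  induction e with
  | _ x y =>
    rw [SimpleGraph.mem_edgeSet, cadj hn] at he
    rcases he with h | h
    · refine ⟨x, ?_⟩
      have : p x 1 = y := Fin.ext h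
      rw [this]
    · refine ⟨y, ?_⟩
      have : p y 1 = x := Fin.ext h
      rw [this, Sym2.eq_swap]

theorem p_succ {n : ℕ} (c : Fin n) (i : ℕ) : p (p c i) 1 = p c (i + 1) := by
  ext
  simp [p, add_assoc]

theorem p_zero {n : ℕ} (c : Fin n) : p c 0 = c := by
  ext
  simp [p, Nat.mod_eq_of_lt c.2]

theorem p_n {n : ℕ} (c : Fin n) : p c n = c := by
  ext
  simp [p, Nat.mod_eq_of_lt c.2]

theorem s_inj {n : ℕ} (c : Fin n) {i j k l : ℕ} (hi : i < n) (hj : j < n) (hk : k < n)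
    (hl : l < n) : s(p c i, p c j) = s(p c k, p c l) ↔ (i = k ∧ j = l) ∨ (i = l ∧ j = k) := by
  constructor
  · intro h
    rw [Sym2.eq_iff] at h
    rcases h with ⟨h1, h2⟩ | ⟨h1, h2⟩
    · exact Or.inl ⟨p_inj c hi hk h1, p_inj c hj hl h2⟩
    · exact Or.inr ⟨p_inj c hi hl h1, p_inj c hj hk h2⟩
  · rintro (⟨rfl, rfl⟩ | ⟨rfl, rfl⟩)
    · rfl
    · exact Sym2.eq_swap

theorem edge_form2 {n : ℕ} (hn : 3 ≤ n) (e : Sym2 (Fin n))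
    (he : e ∈ (SimpleGraph.cycleGraph n).edgeSet) : ∃ c, e = s(p c (n - 1), p c 0) := by
  obtain ⟨x, rfl⟩ := edge_form hn e he
  refine ⟨p x 1, ?_⟩
  have : p (p x 1) (n - 1) = x := by
    conv_rhs => rw [← p_n x]
    ext
    simp only [p, Nat.mod_add_mod]
    congr 1
    omega
  rw [this, p_zero]

theorem num_one {n : ℕ} (hn : 3 ≤ n) (e : Sym2 (Fin n))
    (he : e ∈ (SimpleGraph.cycleGraph n).edgeSet) :
    indepDomNum ((SimpleGraph.cycleGraph n).deleteEdges {e}) = (n + 2) / 3 := by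
  refine num_eq hn _ (SimpleGraph.deleteEdges_le _) ?_
  obtain ⟨c, rfl⟩ := edge_form2 hn e he
  obtain ⟨S, hS, h⟩ := upper hn
    ((SimpleGraph.cycleGraph n).deleteEdges {s(p c (n - 1), p c 0)}) c n (by omega) le_rfl
    (fun i h _ => by
      rw [SimpleGraph.deleteEdges_adj]
      refine ⟨(p_adj hn _ (by omega) h).2 (Or.inl rfl), ?_⟩
      rw [Set.mem_singleton_iff, s_inj c (by omega) (by omega) (by omega) (by omega)]
      omega)
    (fun i j h hj hadj => by
      have := (p_adj hn _ h hj).1 (SimpleGraph.deleteEdges_le _ hadj)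
      omega)
  exact ⟨S, hS, by omega⟩

theorem num_two {n : ℕ} (hn : 3 ≤ n) (hmod : n % 3 = 1) (e f : Sym2 (Fin n)) (hef : e ≠ f)
    (he : e ∈ (SimpleGraph.cycleGraph n).edgeSet) (hf : f ∈ (SimpleGraph.cycleGraph n).edgeSet) :
    indepDomNum ((SimpleGraph.cycleGraph n).deleteEdges {e, f}) = (n + 2) / 3 := by
  refine num_eq hn _ (SimpleGraph.deleteEdges_le _) ?_
  obtain ⟨c, rfl⟩ := edge_form2 hn e he
  obtain ⟨x, rfl⟩ := edge_form hn f hf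
  obtain ⟨k, hk, rfl⟩ := p_surj c x
  rw [p_succ] at *
  have hk' : k + 1 < n := by
    by_contra hc
    have hkn : k = n - 1 := by omega
    apply hef
    rw [show k + 1 = n by omega, p_n, p_zero, hkn]
  obtain ⟨S, hS, h⟩ := upper hn
    ((SimpleGraph.cycleGraph n).deleteEdges {s(p c (n - 1), p c 0), s(p c k, p c (k + 1))})
    c (k + 1) (by omega) (by omega)
    (fun i h _ => by
      rw [SimpleGraph.deleteEdges_adj]
      refine ⟨(p_adj hn _ (by omega) h).2 (Or.inl rfl), ?_⟩
      rw [Set.mem_insert_iff, Set.mem_singleton_iff,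
        s_inj c (by omega) (by omega) (by omega) (by omega),
        s_inj c (by omega) (by omega) (by omega) (by omega)]
      omega)
    (fun i j h hj hadj => by
      rw [SimpleGraph.deleteEdges_adj, p_adj hn _ h hj, Set.mem_insert_iff,
        Set.mem_singleton_iff, s_inj c (by omega) (by omega) (by omega) (by omega),
        s_inj c (by omega) (by omega) (by omega) (by omega)] at hadj
      omega)
  exact ⟨S, hS, by omega⟩

theorem wit_two {n : ℕ} (hn : 3 ≤ n) (hmod : n % 3 ≠ 1) :
    ∃ E' : Set (Sym2 (Fin n)), E' ⊆ (SimpleGraph.cycleGraph n).edgeSet ∧ E'.Nonempty ∧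
    indepDomNum ((SimpleGraph.cycleGraph n).deleteEdges E') ≠
      indepDomNum (SimpleGraph.cycleGraph n) ∧ E'.ncard = 2 := by
  let c : Fin n := ⟨0, by omega⟩
  refine ⟨{s(p c 0, p c 1), s(p c 0, p c (n - 1))}, ?_, ⟨_, Or.inl rfl⟩, ?_, ?_⟩
  · rintro e (rfl | rfl)
    · exact (p_adj hn c (by omega) (by omega)).2 (by omega)
    · exact (p_adj hn c (by omega) (by omega)).2 (by omega)
  · have := num_lower hn ((SimpleGraph.cycleGraph n).deleteEdges
      {s(p c 0, p c 1), s(p c 0, p c (n - 1))}) (SimpleGraph.deleteEdges_le _) {p c 0} (by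
        intro u hu v hadj
        rw [Finset.mem_singleton] at hu
        subst hu
        obtain ⟨j, hj, rfl⟩ := p_surj c v
        have hadj := hadj.symm
        rcases Nat.eq_zero_or_pos j with rfl | hj0
        · exact SimpleGraph.irrefl _ hadj
        rw [SimpleGraph.deleteEdges_adj, p_adj hn _ hj0 hj, Set.mem_insert_iff,
          Set.mem_singleton_iff, s_inj c (by omega) (by omega) (by omega) (by omega),
          s_inj c (by omega) (by omega) (by omega) (by omega)] at hadj
        omega)
    rw [Finset.card_singleton] at this
    rw [num_cycle hn]
    omega
  · rw [Set.ncard_pair]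
    rw [Ne, s_inj c (by omega) (by omega) (by omega) (by omega)]
    omega

theorem wit_three {n : ℕ} (hn : 4 ≤ n) (hmod : n % 3 = 1) :
    ∃ E' : Set (Sym2 (Fin n)), E' ⊆ (SimpleGraph.cycleGraph n).edgeSet ∧ E'.Nonempty ∧
    indepDomNum ((SimpleGraph.cycleGraph n).deleteEdges E') ≠
      indepDomNum (SimpleGraph.cycleGraph n) ∧ E'.ncard = 3 := by
  have hn3 : 3 ≤ n := by omega
  let c : Fin n := ⟨0, by omega⟩
  refine ⟨{s(p c 0, p c 1), s(p c 0, p c (n - 1)), s(p c 1, p c 2)}, ?_, ⟨_, Or.inl rfl⟩, ?_, ?_⟩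
  · rintro e (rfl | rfl | rfl)
    · exact (p_adj hn3 c (by omega) (by omega)).2 (by omega)
    · exact (p_adj hn3 c (by omega) (by omega)).2 (by omega)
    · exact (p_adj hn3 c (by omega) (by omega)).2 (by omega)
  · have hno : ∀ i j, i < j → j < n → i ≤ 1 → ¬ ((SimpleGraph.cycleGraph n).deleteEdges
      {s(p c 0, p c 1), s(p c 0, p c (n - 1)), s(p c 1, p c 2)}).Adj (p c i) (p c j) := by
      intro i j hij hj hi hadj
      rw [SimpleGraph.deleteEdges_adj, p_adj hn3 _ hij hj, Set.mem_insert_iff,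
          Set.mem_insert_iff,
          Set.mem_singleton_iff, s_inj c (by omega) (by omega) (by omega) (by omega),
          s_inj c (by omega) (by omega) (by omega) (by omega),
          s_inj c (by omega) (by omega) (by omega) (by omega)] at hadj
      omega
    have := num_lower hn3 ((SimpleGraph.cycleGraph n).deleteEdges
      {s(p c 0, p c 1), s(p c 0, p c (n - 1)), s(p c 1, p c 2)})
      (SimpleGraph.deleteEdges_le _) {p c 0, p c 1} (by
        intro u hu v hadj
        rw [Finset.mem_insert, Finset.mem_singleton] at hu
        have : ∃ i, i ≤ 1 ∧ u = p c i := by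
          rcases hu with h | h
          · exact ⟨0, by omega, h⟩
          · exact ⟨1, by omega, h⟩
        obtain ⟨i, hi, rfl⟩ := this
        obtain ⟨j, hj, rfl⟩ := p_surj c v
        rcases lt_trichotomy i j with h | h | h
        · exact hno i j h hj hi hadj.symm
        · subst h
          exact SimpleGraph.irrefl _ hadj
        · exact hno j i h (by omega) (by omega) hadj)
    rw [Finset.card_pair (fun h => by
      have := p_inj c (by omega) (by omega) h
      omega)] at this
    rw [num_cycle hn3]
    omega
  · rw [Set.ncard_eq_three]
    refine ⟨_, _, _, ?_, ?_, ?_, rfl⟩ <;>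
    · rw [Ne, s_inj c (by omega) (by omega) (by omega) (by omega)]
      omega

theorem ge_two {n : ℕ} (hn : 3 ≤ n) (E' : Set (Sym2 (Fin n)))
    (h1 : E' ⊆ (SimpleGraph.cycleGraph n).edgeSet) (h2 : E'.Nonempty)
    (h3 : indepDomNum ((SimpleGraph.cycleGraph n).deleteEdges E') ≠
      indepDomNum (SimpleGraph.cycleGraph n)) : 2 ≤ E'.ncard := by
  have hpos : 0 < E'.ncard := (Set.ncard_pos).2 h2
  by_contra hc
  obtain ⟨e, rfl⟩ := Set.ncard_eq_one.1 (show E'.ncard = 1 by omega)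
  exact h3 ((num_one hn e (h1 rfl)).trans (num_cycle hn).symm)

end IdB

/-- For the cycle `C_n` on `n ≥ 3` vertices, `b_id(C_n) = 3` if `n ≡ 1 (mod 3)`
and `b_id(C_n) = 2` otherwise. -/
theorem idBondage_cycle (n : ℕ) (hn : 3 ≤ n) :
    idBondage (SimpleGraph.cycleGraph n) = if n % 3 = 1 then 3 else 2 := by
  unfold idBondage
  split_ifs with hmod
  · refine IsLeast.csInf_eq ⟨IdB.wit_three (by omega) hmod, ?_⟩
    rintro m ⟨E', h1, h2, h3, rfl⟩
    have := IdB.ge_two hn E' h1 h2 h3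
    by_contra hc
    obtain ⟨e, f, hef, rfl⟩ := Set.ncard_eq_two.1 (show E'.ncard = 2 by omega)
    exact h3 ((IdB.num_two hn hmod e f hef (h1 (Or.inl rfl)) (h1 (Or.inr rfl))).trans
      (IdB.num_cycle hn).symm)
  · refine IsLeast.csInf_eq ⟨IdB.wit_two hn hmod, ?_⟩
    rintro m ⟨E', h1, h2, h3, rfl⟩
    exact IdB.ge_two hn E' h1 h2 h3
end

section
/- For every natural number N there exist finite simple graphs G and H, each having at least one edge, such that γ_i(G) = γ_i(H) and |b_id(G) − b_id(H)| ≥ N. In other words, graphs with the same independent domination number can have independent domination bondage numbers that differ by an arbitrarily large amount. -/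
theorem indepDomNum_of_universal {V : Type*} [Finite V] (G : SimpleGraph V) (v : V)
    (hv : ∀ u, u ≠ v → G.Adj v u) : indepDomNum G = 1 := by
  have h1 : indepDomNum G ≤ 1 := by
    apply Nat.sInf_le
    refine ⟨{v}, ⟨?_, ?_⟩, Set.ncard_singleton v⟩
    · rintro a rfl b rfl
      exact G.irrefl
    · intro u hu
      exact ⟨v, rfl, hv u hu⟩
  have hmem : indepDomNum G ∈ {n | ∃ S : Set V, IsIndepDomSet G S ∧ S.ncard = n} := by
    apply Nat.sInf_mem
    refine ⟨1, {v}, ⟨?_, ?_⟩, Set.ncard_singleton v⟩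
    · rintro a rfl b rfl
      exact G.irrefl
    · intro u hu
      exact ⟨v, rfl, hv u hu⟩
  obtain ⟨S, hS, hc⟩ := hmem
  have h0 : S.ncard ≠ 0 := by
    intro h
    rw [Set.ncard_eq_zero] at h
    subst h
    obtain ⟨u, hu, _⟩ := hS.2 v (by simp)
    exact hu
  omega

theorem indepDomNum_empty (n : ℕ) : indepDomNum (⊥ : SimpleGraph (Fin n)) = n := by
  have : {k | ∃ S : Set (Fin n), IsIndepDomSet (⊥ : SimpleGraph (Fin n)) S ∧ S.ncard = k} = {n} := by
    ext k
    constructor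
    · rintro ⟨S, hS, rfl⟩
      have : S = Set.univ := by
        ext v
        simp only [Set.mem_univ, iff_true]
        by_contra hv
        obtain ⟨u, _, h⟩ := hS.2 v hv
        exact h
      subst this
      simp [Set.ncard_univ]
    · rintro rfl
      exact ⟨Set.univ, ⟨fun _ _ _ _ h => h, fun v hv => (hv trivial).elim⟩,
        by simp [Set.ncard_univ]⟩
  unfold indepDomNum
  rw [this]
  simp

theorem indepDomNum_complete (n : ℕ) (hn : 0 < n) :
    indepDomNum (⊤ : SimpleGraph (Fin n)) = 1 :=
  indepDomNum_of_universal _ ⟨0, hn⟩ (fun u hu => by simpa using hu.symm)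

theorem complete_edges_nonempty (n : ℕ) (hn : 2 ≤ n) :
    (⊤ : SimpleGraph (Fin n)).edgeSet.Nonempty :=
  ⟨s(⟨0, by omega⟩, ⟨1, by omega⟩), by simp⟩

theorem idBondage_complete_lower (n : ℕ) (hn : 2 ≤ n) :
    n ≤ 2 * idBondage (⊤ : SimpleGraph (Fin n)) := by
  classical
  have hmem : idBondage (⊤ : SimpleGraph (Fin n)) ∈ {k | ∃ E' : Set (Sym2 (Fin n)),
      E' ⊆ (⊤ : SimpleGraph (Fin n)).edgeSet ∧ E'.Nonempty ∧
      indepDomNum ((⊤ : SimpleGraph (Fin n)).deleteEdges E') ≠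
        indepDomNum (⊤ : SimpleGraph (Fin n)) ∧ E'.ncard = k} := by
    apply Nat.sInf_mem
    refine ⟨_, (⊤ : SimpleGraph (Fin n)).edgeSet, subset_rfl,
      complete_edges_nonempty n hn, ?_, rfl⟩
    have : (⊤ : SimpleGraph (Fin n)).deleteEdges (⊤ : SimpleGraph (Fin n)).edgeSet = ⊥ := by
      ext a b
      simp
    rw [this, indepDomNum_empty, indepDomNum_complete n (by omega)]
    omega
  obtain ⟨E', hE, -, hne, hc⟩ := hmem
  rw [← hc, Set.ncard_eq_toFinset_card']
  have hcov : (Finset.univ : Finset (Fin n)) ⊆ E'.toFinset.biUnion Sym2.toFinset := by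
    intro v _
    by_contra hv
    apply hne
    rw [indepDomNum_complete n (by omega)]
    apply indepDomNum_of_universal _ v
    intro u hu
    rw [SimpleGraph.deleteEdges_adj]
    refine ⟨by simpa using hu.symm, fun h => hv ?_⟩
    rw [Finset.mem_biUnion]
    exact ⟨s(v, u), by simpa using h, by simp⟩
  have h1 := Finset.card_le_card hcov
  have h2 : (E'.toFinset.biUnion Sym2.toFinset).card ≤ E'.toFinset.card * 2 := by
    apply Finset.card_biUnion_le_card_mul
    intro e _
    rw [Sym2.card_toFinset]
    split_ifs <;> omega
  rw [Finset.card_univ, Fintype.card_fin] at h1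
  omega

theorem idBondage_two_le : idBondage (⊤ : SimpleGraph (Fin 2)) ≤ 1 := by
  apply Nat.sInf_le
  refine ⟨{s(0, 1)}, by simp, by simp, ?_, by simp⟩
  have : (⊤ : SimpleGraph (Fin 2)).deleteEdges {s(0, 1)} = ⊥ := by
    ext a b
    fin_cases a <;> fin_cases b <;> simp
  rw [this, indepDomNum_empty, indepDomNum_complete 2 (by omega)]
  omega

/-- Graphs with the same independent domination number can have independent domination
bondage numbers that differ by an arbitrarily large amount: for every `N` there are
finite simple graphs `G`, `H`, each with at least one edge, with `γᵢ(G) = γᵢ(H)` and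
`|b_id(G) - b_id(H)| ≥ N`. -/
theorem idBondage_gap_unbounded (N : ℕ) :
    ∃ (m k : ℕ) (G : SimpleGraph (Fin m)) (H : SimpleGraph (Fin k)),
      G.edgeSet.Nonempty ∧ H.edgeSet.Nonempty ∧
      indepDomNum G = indepDomNum H ∧
      N ≤ ((idBondage G : ℤ) - (idBondage H : ℤ)).natAbs := by
  refine ⟨2 * N + 2, 2, ⊤, ⊤, complete_edges_nonempty _ (by omega),
    complete_edges_nonempty _ le_rfl, ?_, ?_⟩
  · rw [indepDomNum_complete _ (by omega), indepDomNum_complete _ (by omega)]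
  · have h1 := idBondage_complete_lower (2 * N + 2) (by omega)
    have h2 := idBondage_two_le
    omega
end

section
/- Let G be a finite simple graph and let e be an edge of G such that the graph G − e still has at least one edge. Then b_id(G) ≤ b_id(G − e) + 1. -/
theorem exists_isIndepDomSet {V : Type*} [Fintype V] (G : SimpleGraph V) :
    ∃ S : Set V, IsIndepDomSet G S := by
  obtain ⟨S, hS⟩ := (Set.toFinite {S : Set V | ∀ a ∈ S, ∀ b ∈ S, ¬ G.Adj a b}).exists_maximal
    ⟨∅, by simp⟩
  refine ⟨S, hS.1, fun v hv => ?_⟩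
  by_contra hc
  push Not at hc
  have h1 : insert v S ∈ {S : Set V | ∀ a ∈ S, ∀ b ∈ S, ¬ G.Adj a b} := by
    rintro a (rfl | ha) b (rfl | hb) hab
    · exact G.loopless.irrefl _ hab
    · exact hc b hb hab.symm
    · exact hc a ha hab
    · exact hS.1 a ha b hb hab
  exact hv (hS.2 h1 (Set.subset_insert v S) (Set.mem_insert v S))

theorem indepDomNum_bot_ne {V : Type*} [Fintype V] (G : SimpleGraph V)
    (h : G.edgeSet.Nonempty) : indepDomNum (⊥ : SimpleGraph V) ≠ indepDomNum G := by
  have hb : indepDomNum (⊥ : SimpleGraph V) = (Set.univ : Set V).ncard := by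
    obtain ⟨S, hS⟩ := exists_isIndepDomSet (⊥ : SimpleGraph V)
    obtain ⟨T, hT, hc⟩ := Nat.sInf_mem
      (s := {n | ∃ S : Set V, IsIndepDomSet (⊥ : SimpleGraph V) S ∧ S.ncard = n}) ⟨_, S, hS, rfl⟩
    have hu : T = Set.univ := by
      ext v
      simp only [Set.mem_univ, iff_true]
      by_contra hv
      obtain ⟨u, _, hu⟩ := hT.2 v hv
      exact hu
    rw [hu] at hc
    exact hc.symm
  obtain ⟨S, hS⟩ := exists_isIndepDomSet G
  have hle : indepDomNum G ≤ S.ncard := Nat.sInf_le ⟨S, hS, rfl⟩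
  have hlt : S.ncard < (Set.univ : Set V).ncard := by
    apply Set.ncard_lt_ncard _ (Set.toFinite _)
    rw [Set.ssubset_univ_iff]
    rintro rfl
    obtain ⟨e, he⟩ := h
    induction e using Sym2.ind with
    | _ a b => exact hS.1 a trivial b trivial he
  omega

/-- If `e` is an edge of the finite simple graph `G` and `G - e` still has at least one
edge, then `b_id(G) ≤ b_id(G - e) + 1`. -/
theorem idBondage_le_deleteEdge {V : Type*} [Fintype V] (G : SimpleGraph V)
    (e : Sym2 V) (he : e ∈ G.edgeSet)
    (h : (G.deleteEdges {e}).edgeSet.Nonempty) :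
    idBondage G ≤ idBondage (G.deleteEdges {e}) + 1 := by
  by_cases hg : indepDomNum (G.deleteEdges {e}) = indepDomNum G
  · have hne : {n | ∃ E' : Set (Sym2 V), E' ⊆ (G.deleteEdges {e}).edgeSet ∧ E'.Nonempty ∧
        indepDomNum ((G.deleteEdges {e}).deleteEdges E') ≠ indepDomNum (G.deleteEdges {e}) ∧
        E'.ncard = n}.Nonempty := by
      refine ⟨_, (G.deleteEdges {e}).edgeSet, le_rfl, h, ?_, rfl⟩
      have hbot : (G.deleteEdges {e}).deleteEdges (G.deleteEdges {e}).edgeSet = ⊥ := by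
        ext a b
        rw [SimpleGraph.deleteEdges_adj, SimpleGraph.mem_edgeSet]
        simp
      rw [hbot]
      exact indepDomNum_bot_ne _ h
    obtain ⟨E, hE, hEn, hd, hc⟩ := Nat.sInf_mem hne
    have hc' : E.ncard = idBondage (G.deleteEdges {e}) := hc
    have hsub : E ⊆ G.edgeSet :=
      hE.trans (SimpleGraph.edgeSet_mono (SimpleGraph.deleteEdges_le _))
    rw [SimpleGraph.deleteEdges_deleteEdges, hg] at hd
    have h1 : idBondage G ≤ ({e} ∪ E).ncard :=
      Nat.sInf_le ⟨{e} ∪ E, Set.union_subset (by simpa using he) hsub, ⟨e, by simp⟩, hd, rfl⟩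
    have h2 := Set.ncard_union_le {e} E
    rw [Set.ncard_singleton] at h2
    omega
  · have h1 : idBondage G ≤ ({e} : Set (Sym2 V)).ncard :=
      Nat.sInf_le ⟨{e}, by simpa using he, ⟨e, rfl⟩, hg, rfl⟩
    rw [Set.ncard_singleton] at h1
    omega
end
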